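/- Let p be a prime, n ≥ 0 an integer, and k ∈ {1,-1}. For all integers u', v' with 1 ≤ u' ≤ v' ≤ p^{n+1} and v' - u' even, the relation (v'-u')/2 ≺_k u' holds if and only if one of the following holds: (1) there exist integers d, u, v with 0 ≤ d ≤ p-1, 1 ≤ u ≤ v ≤ p^n, v - u even, (v-u)/2 ≺_k u, u' = d·p^n + u and v' = d·p^n + v; or (2) there exist integers d ≥ 0, e ≥ 0 with d + 2 + 2e ≤ p-1 and integers u, v with 1 ≤ u ≤ v ≤ p^n - 1, v - u even, (v-u)/2 ≺_k u, u' = d·p^n + u and v' = (d+2+2e)·p^n + v; or (3) there exist integers d ≥ 0, e ≥ 0 with d + 2 + 2e ≤ p and integers u, v with 1 ≤ u ≤ v ≤ p^n - 1, v - u even, (v-u)/2 ≺_{-k} u, u' = d·p^n + u and v' = (d+2+2e)·p^n - v. (This is the block-recursive description of the matrices A(p^{n+1}) in terms of A(p^n).) -/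

import Mathlib

/-- The `i`-th digit of `a` in base `p`. -/
def pDigit (p a i : ℕ) : ℕ := a / p ^ i % p

/-- `a ⊂ b` : each nonzero base-`p` digit of `a` agrees with the corresponding digit of `b`. -/
def PSub (p a b : ℕ) : Prop := ∀ i, pDigit p a i = 0 ∨ pDigit p a i = pDigit p b i

/-- `a ≺₁ b` : with `s` the `p`-adic valuation of `b`, the digits of `a` vanish up to `s`
and `a_i + b_i < p` above `s`. -/
def PrecOne (p a b : ℕ) : Prop :=
  (∀ i ≤ padicValNat p b, pDigit p a i = 0) ∧
  (∀ i, padicValNat p b < i → pDigit p a i + pDigit p b i < p)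

/-- `a ≺₋₁ b` : with `s` the `p`-adic valuation of `b`, the digits of `a` vanish below `s`,
`a_s + b_s = p`, and `a_i + b_i < p` above `s`. -/
def PrecNegOne (p a b : ℕ) : Prop :=
  (∀ i < padicValNat p b, pDigit p a i = 0) ∧
  pDigit p a (padicValNat p b) + pDigit p b (padicValNat p b) = p ∧
  (∀ i, padicValNat p b < i → pDigit p a i + pDigit p b i < p)

/-- `a ≺ b` : `a ≺₁ b` or `a ≺₋₁ b`. -/
def Prec (p a b : ℕ) : Prop := PrecOne p a b ∨ PrecNegOne p a b

/-- `a ≺_k b` for a sign `k ∈ {1, -1}` : `a ≺₁ b` when `k = 1`, and `a ≺₋₁ b` when `k = -1`. -/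
def PrecK (p : ℕ) (k : ℤ) (a b : ℕ) : Prop :=
  if k = 1 then PrecOne p a b else PrecNegOne p a b

/-- No carry occurs when `a` and `b` are added in base `p`. -/
def NoCarry (p a b : ℕ) : Prop := ∀ i, pDigit p a i + pDigit p b i < p

/-- If `r` is the lowest nonzero digit of `b`, then `a ≺_k b` forces the digit of `a` at the same
position to be `leadDigit p k r`. -/
def leadDigit (p : ℕ) (k : ℤ) (r : ℕ) : ℕ := if k = 1 then 0 else p - r

lemma leadDigit_lt {p r : ℕ} (k : ℤ) (hr : 0 < r) (hrp : r < p) : leadDigit p k r < p := by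
  unfold leadDigit; split_ifs <;> omega

lemma leadDigit_add_leadDigit_neg {p r : ℕ} {k : ℤ} (hk : k = 1 ∨ k = -1) :
    leadDigit p k r + leadDigit p (-k) r = p - r := by
  rcases hk with rfl | rfl <;> simp [leadDigit]

lemma pDigit_zero (p a : ℕ) : pDigit p a 0 = a % p := by simp [pDigit]

lemma pDigit_succ (p a i : ℕ) : pDigit p a (i + 1) = pDigit p (a / p) i := by
  simp [pDigit, pow_succ', Nat.div_div_eq_div_mul]

lemma pDigit_pow_mul_add {p : ℕ} (hp : 0 < p) (s x i : ℕ) :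
    pDigit p (p ^ s * x) (s + i) = pDigit p x i := by
  simp only [pDigit, pow_add, ← Nat.div_div_eq_div_mul]
  rw [Nat.mul_div_cancel_left _ (pow_pos hp s)]

lemma pDigit_pow_mul_self {p : ℕ} (hp : 0 < p) (s x : ℕ) : pDigit p (p ^ s * x) s = x % p := by
  rw [← pDigit_zero]
  exact pDigit_pow_mul_add hp s x 0

lemma mul_add_mod_base {p r : ℕ} (x : ℕ) (hr : r < p) : (p * x + r) % p = r := by
  rw [Nat.mul_add_mod, Nat.mod_eq_of_lt hr]

lemma mul_add_div_base {p r : ℕ} (x : ℕ) (hr : r < p) : (p * x + r) / p = x := by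
  rw [Nat.mul_add_div (by omega), Nat.div_eq_of_lt hr, add_zero]

lemma forall_pDigit_eq_zero_iff {p : ℕ} (hp : 0 < p) (s a : ℕ) :
    (∀ i < s, pDigit p a i = 0) ↔ p ^ s ∣ a := by
  induction s generalizing a with
  | zero => simp
  | succ s ih =>
    constructor
    · intro h
      obtain ⟨x, rfl⟩ := (ih a).1 fun i hi => h i (by omega)
      have hx := h s (by omega)
      rw [pDigit_pow_mul_self hp] at hx
      rw [pow_succ]
      exact mul_dvd_mul_left _ (Nat.dvd_of_mod_eq_zero hx)
    · rintro ⟨x, rfl⟩ i hi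
      have : p ^ (s + 1) * x = p ^ i * (p * (p ^ (s - i) * x)) := by
        rw [← mul_assoc, ← mul_assoc, ← pow_succ, ← pow_add]; congr 2; omega
      rw [this, pDigit_pow_mul_self hp, Nat.mul_mod_right]

lemma noCarry_iff (p a b : ℕ) :
    NoCarry p a b ↔ a % p + b % p < p ∧ NoCarry p (a / p) (b / p) := by
  refine ⟨fun h => ⟨by simpa [pDigit_zero] using h 0, fun i => ?_⟩, fun h i => ?_⟩
  · simpa [pDigit_succ] using h (i + 1)
  · cases i with
    | zero => simpa [pDigit_zero] using h.1
    | succ i => simpa [pDigit_succ] using h.2 i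

lemma noCarry_zero {p : ℕ} (hp : 0 < p) : NoCarry p 0 0 := fun i => by simpa [pDigit] using hp

lemma add_lt_pow_of_noCarry {p : ℕ} (m : ℕ) {a b : ℕ} (ha : a < p ^ m) (hb : b < p ^ m)
    (h : NoCarry p a b) : a + b < p ^ m := by
  induction m generalizing a b with
  | zero => simp at *; omega
  | succ m ih =>
    obtain ⟨h0, h1⟩ := (noCarry_iff p a b).1 h
    rw [pow_succ'] at *
    have := ih (Nat.div_lt_of_lt_mul ha) (Nat.div_lt_of_lt_mul hb) h1
    have e1 := Nat.div_add_mod a p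
    have e2 := Nat.div_add_mod b p
    have := Nat.mul_le_mul_left p (Nat.succ_le_of_lt this)
    rw [Nat.succ_eq_add_one, mul_add, mul_add] at this
    omega

lemma NoCarry.of_add_add_eq {p : ℕ} (hp : 0 < p) (m : ℕ) {a b t : ℕ}
    (hsum : a + b + t + 1 = p ^ m) (h : NoCarry p a t) : NoCarry p b t := by
  induction m generalizing a b t with
  | zero =>
    simp only [pow_zero, Nat.add_eq_right, Nat.add_eq_zero_iff] at hsum
    obtain ⟨⟨rfl, rfl⟩, rfl⟩ := hsum
    exact noCarry_zero hp
  | succ m ih =>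
    obtain ⟨h0, h1⟩ := (noCarry_iff p a t).1 h
    have e1 := Nat.div_add_mod a p
    have e2 := Nat.div_add_mod t p
    have e3 := Nat.div_add_mod b p
    have l3 := Nat.mod_lt b hp
    rw [pow_succ'] at hsum
    have key : p * (a / p + b / p + t / p) + (a % p + b % p + t % p + 1) = p * p ^ m := by
      rw [mul_add, mul_add]; omega
    have hdvd : p ∣ a % p + b % p + t % p + 1 :=
      (Nat.dvd_add_right (dvd_mul_right p _)).1 (key ▸ dvd_mul_right p _)
    obtain ⟨c, hc⟩ := hdvd
    have hc1 : c = 1 := by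
      have : c < 2 := by
        by_contra hcon
        have := Nat.mul_le_mul_left p (not_lt.1 hcon)
        omega
      interval_cases c
      · omega
      · rfl
    subst hc1
    rw [hc, ← mul_add] at key
    refine (noCarry_iff p b t).2 ⟨by omega, ih (Nat.eq_of_mul_eq_mul_left hp key) h1⟩

lemma noCarry_block_iff {p c d : ℕ} (hp : 0 < p) (hc : c < p) (hd : d < p) (m : ℕ) {a t : ℕ}
    (ha : a < p ^ m) (ht : t < p ^ m) :
    NoCarry p (c * p ^ m + a) (d * p ^ m + t) ↔ NoCarry p a t ∧ c + d < p := by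
  induction m generalizing a t with
  | zero =>
    simp only [pow_zero, Nat.lt_one_iff] at ha ht
    subst ha ht
    rw [noCarry_iff]
    simp [Nat.mod_eq_of_lt hc, Nat.mod_eq_of_lt hd, Nat.div_eq_of_lt hc, Nat.div_eq_of_lt hd,
      noCarry_zero hp]
  | succ m ih =>
    rw [pow_succ'] at *
    have hmod : ∀ x y, (x * (p * p ^ m) + y) % p = y % p := fun x y => by
      rw [mul_left_comm, Nat.mul_add_mod]
    have hdiv : ∀ x y, (x * (p * p ^ m) + y) / p = x * p ^ m + y / p := fun x y => by
      rw [mul_left_comm, Nat.mul_add_div hp]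
    rw [noCarry_iff, hmod, hmod, hdiv, hdiv,
      ih (Nat.div_lt_of_lt_mul ha) (Nat.div_lt_of_lt_mul ht), noCarry_iff p a t, and_assoc]

lemma padicValNat_pow_mul_add {p : ℕ} (hp : p.Prime) (s t : ℕ) {r : ℕ} (hr : 0 < r)
    (hrp : r < p) : padicValNat p (p ^ s * (p * t + r)) = s := by
  have := Fact.mk hp
  have hnd : ¬ p ∣ p * t + r := fun h =>
    Nat.not_dvd_of_pos_of_lt hr hrp ((Nat.dvd_add_right (dvd_mul_right p t)).1 h)
  rw [padicValNat.mul (pow_pos hp.pos s).ne' (by omega), padicValNat.prime_pow,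
    padicValNat.eq_zero_of_not_dvd hnd, add_zero]

lemma exists_eq_pow_mul_add {p : ℕ} (hp : p.Prime) {u : ℕ} (hu : 0 < u) :
    ∃ s t r, 0 < r ∧ r < p ∧ u = p ^ s * (p * t + r) := by
  obtain ⟨s, x, hx, rfl⟩ := Nat.exists_eq_pow_mul_and_not_dvd hu.ne' p hp.ne_one
  refine ⟨s, x / p, x % p, ?_, Nat.mod_lt _ hp.pos, by rw [Nat.div_add_mod]⟩
  exact Nat.pos_of_ne_zero fun h => hx (Nat.dvd_of_mod_eq_zero h)

lemma precK_pow_mul_add_iff {p : ℕ} (hp : p.Prime) (k : ℤ) (s t a : ℕ) {r : ℕ} (hr : 0 < r)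
    (hrp : r < p) :
    PrecK p k a (p ^ s * (p * t + r)) ↔
      ∃ x, a = p ^ s * (p * x + leadDigit p k r) ∧ NoCarry p x t := by
  have hu : ∀ i, pDigit p (p ^ s * (p * t + r)) (s + i) = pDigit p (p * t + r) i :=
    pDigit_pow_mul_add hp.pos s _
  have hus : pDigit p (p ^ s * (p * t + r)) s = r := by
    rw [pDigit_pow_mul_self hp.pos, mul_add_mod_base _ hrp]
  have hdig : PrecK p k a (p ^ s * (p * t + r)) ↔ (∀ i < s, pDigit p a i = 0) ∧
      pDigit p a s = leadDigit p k r ∧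
      ∀ i, pDigit p a (s + (i + 1)) + pDigit p t i < p := by
    have habove : (∀ i, s < i → pDigit p a i + pDigit p (p ^ s * (p * t + r)) i < p) ↔
        ∀ i, pDigit p a (s + (i + 1)) + pDigit p t i < p := by
      have hut : ∀ i, pDigit p (p ^ s * (p * t + r)) (s + (i + 1)) = pDigit p t i := fun i => by
        rw [hu, pDigit_succ, mul_add_div_base _ hrp]
      constructor
      · intro h i
        simpa only [hut] using h (s + (i + 1)) (by omega)
      · intro h i hi
        obtain ⟨j, rfl⟩ : ∃ j, i = s + (j + 1) := ⟨i - s - 1, by omega⟩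
        simpa only [hut] using h j
    unfold PrecK leadDigit
    split_ifs
    · rw [PrecOne, padicValNat_pow_mul_add hp s t hr hrp, habove, ← and_assoc]
      refine and_congr_left fun _ => ⟨fun h => ⟨fun i hi => h i hi.le, h s le_rfl⟩, fun h i hi => ?_⟩
      rcases hi.lt_or_eq with hi | rfl
      exacts [h.1 i hi, h.2]
    · rw [PrecNegOne, padicValNat_pow_mul_add hp s t hr hrp, habove, hus]
      refine and_congr_right fun _ => and_congr_left fun _ => ?_
      omega
  rw [hdig, forall_pDigit_eq_zero_iff hp.pos]
  have hlead := leadDigit_lt k hr hrp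
  constructor
  · rintro ⟨⟨y, rfl⟩, h0, h1⟩
    have hy : y % p = leadDigit p k r := by
      rw [← h0, pDigit_pow_mul_self hp.pos]
    refine ⟨y / p, by rw [← hy, Nat.div_add_mod], fun i => ?_⟩
    simpa only [pDigit_pow_mul_add hp.pos, pDigit_succ] using h1 i
  · rintro ⟨x, rfl, hx⟩
    refine ⟨dvd_mul_right _ _, ?_, fun i => ?_⟩
    · have := pDigit_pow_mul_add hp.pos s (p * x + leadDigit p k r) 0
      rwa [add_zero, pDigit_zero, mul_add_mod_base _ hlead] at this
    · rw [pDigit_pow_mul_add hp.pos, pDigit_succ, mul_add_div_base _ hlead]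
      exact hx i

lemma lt_pow_of_pow_mul_lt {p : ℕ} (s m : ℕ) {x r : ℕ} (h : p ^ s * (p * x + r) < p ^ (s + (m + 1))) :
    x < p ^ m := by
  rw [pow_add, pow_succ'] at h
  have := lt_of_mul_lt_mul_left h (Nat.zero_le _)
  exact lt_of_mul_lt_mul_left (lt_of_le_of_lt (Nat.le_add_right _ r) this) (Nat.zero_le _)

lemma exists_eq_pow_mul_add_of_lt {p n : ℕ} (hp : p.Prime) {u : ℕ} (hu : 0 < u)
    (hun : u < p ^ n) :
    ∃ s m t r, n = s + (m + 1) ∧ 0 < r ∧ r < p ∧ t < p ^ m ∧ u = p ^ s * (p * t + r) := by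
  obtain ⟨s, t, r, hr, hrp, rfl⟩ := exists_eq_pow_mul_add hp hu
  have hsn : s < n := by
    refine (Nat.pow_lt_pow_iff_right hp.one_lt).1 (lt_of_le_of_lt ?_ hun)
    exact Nat.le_mul_of_pos_right _ (by omega)
  obtain ⟨m, rfl⟩ : ∃ m, n = s + (m + 1) := ⟨n - s - 1, by omega⟩
  exact ⟨s, m, t, r, rfl, hr, hrp, lt_pow_of_pow_mul_lt s m hun, rfl⟩

/-- Prepending top digits `c` and `d` preserves `≺_k` exactly when these do not carry. -/
lemma precK_block_iff {p n c d a u : ℕ} {k : ℤ} (hp : p.Prime) (hc : c < p) (hd : d < p)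
    (hu : 0 < u) (hun : u < p ^ n) (ha : a < p ^ n) :
    PrecK p k (c * p ^ n + a) (d * p ^ n + u) ↔ PrecK p k a u ∧ c + d < p := by
  obtain ⟨s, m, t, r, rfl, hr, hrp, ht, rfl⟩ := exists_eq_pow_mul_add_of_lt hp hu hun
  have hblock : ∀ x y z, x * p ^ (s + (m + 1)) + p ^ s * (p * y + z) =
      p ^ s * (p * (x * p ^ m + y) + z) := fun x y z => by ring
  have hlead := leadDigit_lt k hr hrp
  rw [hblock, precK_pow_mul_add_iff hp k s _ _ hr hrp, precK_pow_mul_add_iff hp k s _ _ hr hrp]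
  constructor
  · rintro ⟨x, hx, hxt⟩
    have hdvd : p ^ s ∣ a := by
      refine (Nat.dvd_add_right (Dvd.dvd.mul_left (pow_dvd_pow p (Nat.le_add_right s (m + 1))) c)).1 ?_
      exact hx ▸ dvd_mul_right _ _
    obtain ⟨y, rfl⟩ := hdvd
    have hy : y = p * (y / p) + y % p := (Nat.div_add_mod y p).symm
    rw [hy, hblock] at hx
    rw [hy] at ha
    have hx' := Nat.eq_of_mul_eq_mul_left (pow_pos hp.pos s) hx
    have hq := congrArg (· / p) hx'
    have hm := congrArg (· % p) hx'
    simp only [mul_add_div_base _ hlead, mul_add_div_base _ (Nat.mod_lt y hp.pos)] at hq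
    simp only [mul_add_mod_base _ hlead, mul_add_mod_base _ (Nat.mod_lt y hp.pos)] at hm
    rw [← hq, noCarry_block_iff hp.pos hc hd m (lt_pow_of_pow_mul_lt s m ha) ht] at hxt
    exact ⟨⟨y / p, by rw [← hm, ← hy], hxt.1⟩, hxt.2⟩
  · rintro ⟨⟨x, rfl, hx⟩, hcd⟩
    refine ⟨c * p ^ m + x, hblock _ _ _, ?_⟩
    exact (noCarry_block_iff hp.pos hc hd m (lt_pow_of_pow_mul_lt s m ha) ht).2 ⟨hx, hcd⟩

/-- Reflection: if `a + b + u = p ^ n` then `a ≺_k u` implies `b ≺_{-k} u`. -/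
lemma PrecK.reflect {p n a b u : ℕ} {k : ℤ} (hp : p.Prime) (hk : k = 1 ∨ k = -1) (hu : 0 < u)
    (hun : u < p ^ n) (hsum : a + b + u = p ^ n) (h : PrecK p k a u) : PrecK p (-k) b u := by
  obtain ⟨s, m, t, r, rfl, hr, hrp, ht, rfl⟩ := exists_eq_pow_mul_add_of_lt hp hu hun
  rw [precK_pow_mul_add_iff hp _ s _ _ hr hrp] at h ⊢
  obtain ⟨x, rfl, hx⟩ := h
  have hlead := leadDigit_add_leadDigit_neg (p := p) (r := r) hk
  have hpow : p ^ (s + (m + 1)) = p ^ s * (p * p ^ m) := by ring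
  rw [hpow] at hsum
  have hdvd : p ^ s ∣ b := by
    have h1 : p ^ s ∣ p ^ s * (p * x + leadDigit p k r) + p ^ s * (p * t + r) := by
      rw [← mul_add]; exact dvd_mul_right _ _
    refine (Nat.dvd_add_right h1).1 ⟨p * p ^ m, ?_⟩
    rw [← hsum]; ring
  obtain ⟨y, rfl⟩ := hdvd
  rw [← mul_add, ← mul_add] at hsum
  have hy := Nat.eq_of_mul_eq_mul_left (pow_pos hp.pos s) hsum
  have hlt : x + t < p ^ m := by
    by_contra hcon
    have := Nat.mul_le_mul_left p (not_lt.1 hcon)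
    rw [mul_add] at this
    omega
  obtain ⟨z, hz⟩ : ∃ z, x + z + t + 1 = p ^ m := ⟨p ^ m - x - t - 1, by omega⟩
  refine ⟨z, ?_, hx.of_add_add_eq hp.pos m hz⟩
  have := congrArg (p * ·) hz
  simp only [mul_add, mul_one] at this
  congr 1
  omega

lemma PrecK.add_le_pow {p n a u : ℕ} {k : ℤ} (hp : p.Prime) (hu : 0 < u) (hun : u < p ^ n)
    (ha : a < p ^ n) (h : PrecK p k a u) : a + u ≤ p ^ n := by
  obtain ⟨s, m, t, r, rfl, hr, hrp, ht, rfl⟩ := exists_eq_pow_mul_add_of_lt hp hu hun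
  rw [precK_pow_mul_add_iff hp _ s _ _ hr hrp] at h
  obtain ⟨x, rfl, hx⟩ := h
  have hlt := Nat.mul_le_mul_left p
    (Nat.succ_le_of_lt (add_lt_pow_of_noCarry m (lt_pow_of_pow_mul_lt s m ha) ht hx))
  rw [Nat.succ_eq_add_one, mul_add, mul_add] at hlt
  have hlead : leadDigit p k r + r ≤ p := by unfold leadDigit; split_ifs <;> omega
  rw [← mul_add, pow_add, pow_succ']
  exact Nat.mul_le_mul_left _ (by omega)

lemma PrecK.add_two_mul_ne_pow {p n a u : ℕ} {k : ℤ} (hp : p.Prime) (hu : 0 < u)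
    (hun : u < p ^ n) (h : PrecK p k a u) : u + 2 * a ≠ p ^ n := by
  obtain ⟨s, m, t, r, rfl, hr, hrp, ht, rfl⟩ := exists_eq_pow_mul_add_of_lt hp hu hun
  rw [precK_pow_mul_add_iff hp _ s _ _ hr hrp] at h
  obtain ⟨x, rfl, hx⟩ := h
  intro heq
  have heq' : p ^ s * (p * (t + 2 * x) + (r + 2 * leadDigit p k r)) = p ^ s * (p * p ^ m) := by
    rw [← pow_succ', ← pow_add, ← heq]; ring
  have hp' := Nat.eq_of_mul_eq_mul_left (pow_pos hp.pos s) heq'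
  have hdvd : p ∣ r + 2 * leadDigit p k r :=
    (Nat.dvd_add_right (dvd_mul_right p _)).1 (hp' ▸ dvd_mul_right p _)
  apply Nat.not_dvd_of_pos_of_lt hr hrp
  unfold leadDigit at hdvd
  split_ifs at hdvd
  · simpa using hdvd
  · have : r + (r + 2 * (p - r)) = p * 2 := by omega
    exact (Nat.dvd_add_left hdvd).1 (this ▸ dvd_mul_right p 2)

lemma precK_zero_iff {p u : ℕ} {k : ℤ} (hp : p.Prime) (hu : 0 < u) : PrecK p k 0 u ↔ k = 1 := by
  obtain ⟨s, t, r, hr, hrp, rfl⟩ := exists_eq_pow_mul_add hp hu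
  rw [precK_pow_mul_add_iff hp k s t 0 hr hrp]
  constructor
  · rintro ⟨x, hx, -⟩
    by_contra hk
    have := (mul_eq_zero.1 hx.symm).resolve_left (pow_pos hp.pos s).ne'
    simp only [leadDigit, if_neg hk] at this
    omega
  · rintro rfl
    exact ⟨0, by simp [leadDigit], fun i => by simpa [pDigit] using Nat.mod_lt _ hp.pos⟩

/-- Above a multiple of `p ^ n`, `a ≺_k c * p ^ n` leaves no room for `a ≠ 0`. -/
lemma PrecK.eq_zero_of_mul_pow {p n c a : ℕ} {k : ℤ} (hp : p.Prime) (hc : 0 < c)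
    (hle : c * p ^ n + 2 * a ≤ p ^ (n + 1)) (h : PrecK p k a (c * p ^ n)) : a = 0 := by
  have hN := pow_pos hp.pos n
  have hcp : c ≤ p := by
    refine Nat.le_of_mul_le_mul_right (c := p ^ n) ?_ hN
    rw [← pow_succ']; omega
  rcases hcp.eq_or_lt with rfl | hcp
  · rw [pow_succ'] at hle; omega
  · have hform : c * p ^ n = p ^ n * (p * 0 + c) := by ring
    rw [hform] at h
    obtain ⟨x, rfl, -⟩ := (precK_pow_mul_add_iff hp k n 0 a hc hcp).1 h
    have hle' : p ^ n * (c + 2 * (p * x + leadDigit p k c)) ≤ p ^ n * p := by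
      rw [← pow_succ]; refine le_trans (le_of_eq ?_) hle; ring
    have hle2 := Nat.le_of_mul_le_mul_left hle' hN
    have hx : x = 0 := by
      by_contra hx
      have := Nat.le_mul_of_pos_right p (Nat.pos_of_ne_zero hx)
      omega
    subst hx
    have : leadDigit p k c = 0 := by
      unfold leadDigit at hle2 ⊢
      split_ifs at hle2 ⊢ <;> omega
    simp [this]

lemma block_unique {N d₁ d₂ u₁ u₂ : ℕ} (h : d₁ * N + u₁ = d₂ * N + u₂) (h₁ : 1 ≤ u₁)
    (h₁' : u₁ ≤ N) (h₂ : 1 ≤ u₂) (h₂' : u₂ ≤ N) : d₁ = d₂ ∧ u₁ = u₂ := by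
  rcases lt_trichotomy d₁ d₂ with hlt | rfl | hlt
  · have := Nat.mul_le_mul_right N (Nat.succ_le_of_lt hlt)
    rw [Nat.succ_eq_add_one, add_mul] at this
    omega
  · omega
  · have := Nat.mul_le_mul_right N (Nat.succ_le_of_lt hlt)
    rw [Nat.succ_eq_add_one, add_mul] at this
    omega

/-- Block-recursive description of the matrices `A(p^{n+1})` in terms of `A(p^n)`.  For a
prime `p`, `n ≥ 0`, a sign `k ∈ {1, -1}`, and `1 ≤ u' ≤ v' ≤ p^{n+1}` with `v' - u'` even,
one has `(v'-u')/2 ≺_k u'` if and only if one of the three listed block cases holds. -/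
theorem prec_block_recursion (p n : ℕ) (k : ℤ) (hp : p.Prime) (hk : k = 1 ∨ k = -1)
    (u' v' : ℕ) (hu' : 1 ≤ u') (huv' : u' ≤ v') (hv' : v' ≤ p ^ (n + 1)) (he : 2 ∣ v' - u') :
    PrecK p k ((v' - u') / 2) u' ↔
      (∃ d u v, d ≤ p - 1 ∧ 1 ≤ u ∧ u ≤ v ∧ v ≤ p ^ n ∧ 2 ∣ v - u ∧
        PrecK p k ((v - u) / 2) u ∧ u' = d * p ^ n + u ∧ v' = d * p ^ n + v) ∨
      (∃ d e u v, d + 2 + 2 * e ≤ p - 1 ∧ 1 ≤ u ∧ u ≤ v ∧ v ≤ p ^ n - 1 ∧ 2 ∣ v - u ∧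
        PrecK p k ((v - u) / 2) u ∧ u' = d * p ^ n + u ∧ v' = (d + 2 + 2 * e) * p ^ n + v) ∨
      (∃ d e u v, d + 2 + 2 * e ≤ p ∧ 1 ≤ u ∧ u ≤ v ∧ v ≤ p ^ n - 1 ∧ 2 ∣ v - u ∧
        PrecK p (-k) ((v - u) / 2) u ∧ u' = d * p ^ n + u ∧ v' = (d + 2 + 2 * e) * p ^ n - v) := by
  have hN := pow_pos hp.pos n
  obtain ⟨a, ha⟩ := he
  obtain rfl : v' = u' + 2 * a := by omega
  rw [ha, Nat.mul_div_cancel_left a two_pos]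
  clear huv' ha
  obtain ⟨d, u, rfl, hu, huN⟩ : ∃ d u, u' = d * p ^ n + u ∧ 1 ≤ u ∧ u ≤ p ^ n := by
    refine ⟨(u' - 1) / p ^ n, (u' - 1) % p ^ n + 1, ?_, Nat.succ_pos _, Nat.mod_lt _ hN⟩
    have := Nat.div_add_mod' (u' - 1) (p ^ n)
    omega
  have hsub : ∀ x b : ℕ, (x + 2 * b - x) / 2 = b := fun x b => by omega
  have hd : d < p := by
    refine lt_of_mul_lt_mul_right (a := p ^ n) ?_ hN.le
    rw [← pow_succ']; omega
  rcases huN.eq_or_lt with rfl | huN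
  · have hpos : 0 < d * p ^ n + p ^ n := by omega
    constructor
    · intro h
      obtain rfl : a = 0 := by
        have hform : d * p ^ n + p ^ n = (d + 1) * p ^ n := by ring
        rw [hform] at h hv'
        exact h.eq_zero_of_mul_pow hp d.succ_pos hv'
      rw [precK_zero_iff hp hpos] at h
      refine Or.inl ⟨d, p ^ n, p ^ n, by omega, hu, le_rfl, le_rfl, by simp, ?_, rfl, by simp⟩
      rw [Nat.sub_self, Nat.zero_div]
      exact (precK_zero_iff hp hN).2 h
    · rintro (⟨d₁, u₁, v₁, -, h1, h2, h3, -, h, heq, hveq⟩ |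
        ⟨d₁, e, u₁, v₁, -, h1, h2, h3, -, h, heq, -⟩ | ⟨d₁, e, u₁, v₁, -, h1, h2, h3, -, h, heq, -⟩)
      · obtain ⟨rfl, rfl⟩ := block_unique heq hu le_rfl h1 (by omega)
        obtain rfl : v₁ = p ^ n := by omega
        obtain rfl : a = 0 := by omega
        rw [Nat.sub_self, Nat.zero_div, precK_zero_iff hp hN] at h
        exact (precK_zero_iff hp hpos).2 h
      · have := (block_unique heq hu le_rfl h1 (by omega)).2
        omega
      · have := (block_unique heq hu le_rfl h1 (by omega)).2
        omega
  constructor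
  · intro h
    obtain ⟨c, b, rfl, hb⟩ : ∃ c b, a = c * p ^ n + b ∧ b < p ^ n :=
      ⟨a / p ^ n, a % p ^ n, (Nat.div_add_mod' _ _).symm, Nat.mod_lt _ hN⟩
    have hdc : (d + 2 * c) * p ^ n + (u + 2 * b) ≤ p * p ^ n := by
      rw [← pow_succ']; refine le_trans (le_of_eq ?_) hv'; ring
    have hc : c < p := by
      by_contra hcon
      have h1 := Nat.mul_le_mul_right (p ^ n) (show p ≤ d + 2 * c by omega)
      omega
    obtain ⟨h, -⟩ := (precK_block_iff hp hc hd hu huN hb).1 h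
    have hne := h.add_two_mul_ne_pow hp hu huN
    have hle := h.add_le_pow hp hu huN hb
    rcases lt_or_gt_of_ne hne with hlt | hgt
    · rcases c with _ | e
      · refine Or.inl ⟨d, u, u + 2 * b, by omega, hu, by omega, hlt.le, by simp, ?_, rfl, by ring⟩
        rwa [hsub]
      · have hdp : d + 2 * (e + 1) < p := by
          refine lt_of_mul_lt_mul_right (a := p ^ n) ?_ hN.le
          omega
        refine Or.inr (Or.inl ⟨d, e, u, u + 2 * b, by omega, hu, by omega, by omega, by simp, ?_,
          rfl, by ring⟩)
        rwa [hsub]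
    · have hdp : d + 2 * c + 1 < p := by
        refine lt_of_mul_lt_mul_right (a := p ^ n) ?_ hN.le
        rw [add_mul]
        omega
      obtain ⟨b', hb'⟩ : ∃ b', b + b' + u = p ^ n := ⟨p ^ n - b - u, by omega⟩
      refine Or.inr (Or.inr ⟨d, c, u, u + 2 * b', by omega, hu, by omega, by omega, by simp, ?_,
        rfl, ?_⟩)
      · rw [hsub]
        exact h.reflect hp hk hu huN hb'
      · refine Nat.eq_sub_of_add_eq ?_
        rw [← hb']; ring
  · rintro (⟨d₁, u₁, v₁, hd₁, h1, h2, h3, ⟨b, hb⟩, h, heq, hveq⟩ |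
      ⟨d₁, e, u₁, v₁, hd₁, h1, h2, h3, ⟨b, hb⟩, h, heq, hveq⟩ |
      ⟨d₁, e, u₁, v₁, hd₁, h1, h2, h3, ⟨b, hb⟩, h, heq, hveq⟩) <;>
    obtain ⟨rfl, rfl⟩ := block_unique heq hu huN.le h1 (by omega) <;>
    obtain rfl : v₁ = u + 2 * b := by omega
    · obtain rfl : a = 0 * p ^ n + b := by omega
      rw [hsub] at h
      exact (precK_block_iff hp hp.pos hd hu huN (by omega)).2 ⟨h, by omega⟩
    · obtain rfl : a = (e + 1) * p ^ n + b := by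
        have : (d + 2 + 2 * e) * p ^ n = d * p ^ n + 2 * ((e + 1) * p ^ n) := by ring
        omega
      rw [hsub] at h
      exact (precK_block_iff hp (by omega) hd hu huN (by omega)).2 ⟨h, by omega⟩
    · obtain ⟨b', hb'⟩ : ∃ b', b + b' + u = p ^ n := ⟨p ^ n - b - u, by omega⟩
      obtain rfl : a = e * p ^ n + b' := by
        have : (d + 2 + 2 * e) * p ^ n = d * p ^ n + 2 * (e * p ^ n) + 2 * p ^ n := by ring
        omega
      rw [hsub] at h
      have h' := h.reflect hp (by omega) hu huN hb'
      rw [neg_neg] at h'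
      exact (precK_block_iff hp (by omega) hd hu huN (by omega)).2 ⟨h', by omega⟩
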